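/- For every integer k ≥ 1 there exist constants C > 0 and N such that for every integer n ≥ N there is a graph U with at most 20n vertices and at most 20·k·n·(log₂ n)·(log_{3/2} log₂ n) + C·k·n·(ln n) edges such that U contains every graph with n vertices and treewidth at most k. -/

import Mathlib

open SimpleGraph

def Contains {V W : Type*} (U : SimpleGraph V) (G : SimpleGraph W) : Prop :=
  ∃ f : G →g U, Function.Injective f

def IsWSubtree {V : Type*} (F : SimpleGraph V) (W : Set V) (H : F.Subgraph) : Prop :=
  H.coe.IsTree ∧ (∀ w ∈ W, (H.neighborSet w).Subsingleton) ∧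
    ∀ H' : F.Subgraph, H ≤ H' → H'.coe.IsTree →
      (∀ w ∈ W, (H'.neighborSet w).Subsingleton) → H' = H

noncomputable def ratio (w : ℕ) : ℝ := (2 + (2/3 : ℝ) ^ w) / (1 + (2/3 : ℝ) ^ w)
noncomputable def alphaF (w p : ℕ) : ℝ := (1 / (1 + (2/3 : ℝ) ^ w)) * ratio w ^ (p - 1)
noncomputable def betaF (w : ℕ) : ℝ := 3 * (3/2 : ℝ) ^ w
noncomputable def gammaF (w p : ℕ) : ℝ := ratio w ^ p
noncomputable def deltaF (w : ℕ) : ℝ := (2 + (2/3 : ℝ) ^ w) * betaF w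
noncomputable def pW (w : ℕ) : ℕ := sInf {p : ℕ | betaF w ≤ alphaF w (p + 1)}

noncomputable def betaK (k w : ℕ) : ℝ := (2 * k + 4) * (3/2 : ℝ) ^ w
noncomputable def deltaK (k w : ℕ) : ℝ := (2 + (2/3 : ℝ) ^ w) * betaK k w
noncomputable def pWK (k w : ℕ) : ℕ := sInf {p : ℕ | betaK k w ≤ alphaF w (p + 1)}

def JVert (a b : ℕ) : ℕ → Type
  | 0 => Fin b
  | m + 1 => Fin a ⊕ (JVert a b m ⊕ JVert a b m)

def JGraph (a b : ℕ) : (m : ℕ) → SimpleGraph (JVert a b m)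
  | 0 => ⊤
  | m + 1 => SimpleGraph.fromRel (fun u v =>
      match u, v with
      | Sum.inl _, _ => True
      | Sum.inr (Sum.inl x), Sum.inr (Sum.inl y) => (JGraph a b m).Adj x y
      | Sum.inr (Sum.inr x), Sum.inr (Sum.inr y) => (JGraph a b m).Adj x y
      | _, _ => False)

noncomputable def GwpVert (w p : ℕ) : Type := JVert (w + 1) ⌈deltaF w⌉₊ (p - pW w)
noncomputable def Gwp (w p : ℕ) : SimpleGraph (GwpVert w p) := JGraph _ _ _

noncomputable def GkwpVert (k w p : ℕ) : Type := JVert ((k + 1) * (w + 1)) ⌈deltaK k w⌉₊ (p - pWK k w)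
noncomputable def Gkwp (k w p : ℕ) : SimpleGraph (GkwpVert k w p) := JGraph _ _ _

structure TreeDecomp {V : Type*} {ι : Type*} (G : SimpleGraph V) (T : SimpleGraph ι) where
  isTree : T.IsTree
  bag : ι → Set V
  bag_connected : ∀ v : V, (T.induce {x | v ∈ bag x}).Connected
  bag_edge : ∀ ⦃u v : V⦄, G.Adj u v → ∃ x, u ∈ bag x ∧ v ∈ bag x

def HasTreewidthLE {V : Type*} (G : SimpleGraph V) (k : ℕ) : Prop :=
  ∃ (ι : Type) (T : SimpleGraph ι) (td : TreeDecomp G T), ∀ x, (td.bag x).ncard ≤ k + 1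

/-- The first vertex after `x` on a path from `x` to `z` in an acyclic graph does not change when
`z` is replaced by a neighbour of `z` distinct from `x`. -/
lemma snd_eq_snd_of_adj {ι : Type*} {T : SimpleGraph ι} (hT : T.IsAcyclic) {x z z' : ι}
    {p : T.Walk x z} {q : T.Walk x z'} (hp : p.IsPath) (hq : q.IsPath) (hz : z ≠ x) (hz' : z' ≠ x)
    (h : T.Adj z z') : p.snd = q.snd := by
  classical
  by_cases hmem : z' ∈ p.support
  · have : (⟨q, hq⟩ : T.Path x z') = ⟨p.takeUntil z' hmem, hp.takeUntil hmem⟩ :=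
      (hT.subsingleton_path _ _).elim _ _
    rw [show q = p.takeUntil z' hmem from congrArg Subtype.val this, Walk.snd_takeUntil hz']
  · have hpq : (⟨q, hq⟩ : T.Path x z') = ⟨p.concat h, hp.concat hmem h⟩ :=
      (hT.subsingleton_path _ _).elim _ _
    have hqz : z ∈ q.support := by
      rw [show q = p.concat h from congrArg Subtype.val hpq]
      simp [Walk.support_concat]
    have : (⟨p, hp⟩ : T.Path x z) = ⟨q.takeUntil z hqz, hq.takeUntil hqz⟩ :=
      (hT.subsingleton_path _ _).elim _ _
    rw [show p = q.takeUntil z hqz from congrArg Subtype.val this, Walk.snd_takeUntil hz]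

/-- The vertices of a tree other than `x` can be labelled by neighbours of `x` so that adjacent
vertices share their label and every vertex is closer to its label than to `x`. -/
lemma exists_branch_label {ι : Type*} {T : SimpleGraph ι} (hT : T.IsTree) (x : ι) :
    ∃ s : ι → ι, (∀ z z', z ≠ x → z' ≠ x → T.Adj z z' → s z = s z') ∧
      ∀ z, z ≠ x → T.Adj x (s z) ∧ T.dist (s z) z + 1 ≤ T.dist x z := by
  choose p hp hlen using fun z => hT.connected.exists_path_of_dist x z
  refine ⟨fun z => (p z).snd, fun z z' hz hz' h =>
    snd_eq_snd_of_adj hT.isAcyclic (hp z) (hp z') hz hz' h, fun z hz => ?_⟩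
  have hnil : ¬ (p z).Nil := Walk.not_nil_of_ne hz.symm
  refine ⟨Walk.adj_snd hnil, ?_⟩
  rw [← hlen z, ← Walk.length_tail_add_one hnil]
  exact Nat.add_le_add_right (dist_le _) 1

/-- A function that is constant along edges of a connected induced subgraph is constant on it. -/
lemma eq_of_connected_induce {ι β : Type*} {T : SimpleGraph ι} {A : Set ι}
    (hA : (T.induce A).Connected) {f : ι → β}
    (hf : ∀ x ∈ A, ∀ y ∈ A, T.Adj x y → f x = f y) {x y : ι} (hx : x ∈ A) (hy : y ∈ A) :
    f x = f y := by
  obtain ⟨p⟩ := hA.preconnected ⟨x, hx⟩ ⟨y, hy⟩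
  have key : ∀ {a b : A}, (T.induce A).Walk a b → f a = f b := by
    intro a b p
    induction p with
    | nil => rfl
    | cons h _ ih => exact (hf _ (Subtype.prop _) _ (Subtype.prop _) h).trans ih
  exact key p

/-- Balanced separators: in a graph of treewidth at most `k`, every vertex set `S` is cut by at
most `k + 1` vertices into classes with at most half of the vertices of `S` each. -/
lemma HasTreewidthLE.exists_balanced_separator {V : Type*} [Fintype V] [DecidableEq V]
    {G : SimpleGraph V} {k : ℕ} (hG : HasTreewidthLE G k) (S : Finset V) :
    ∃ (X : Finset V) (ι : Type) (c : V → ι), X.card ≤ k + 1 ∧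
      (∀ u v, u ∉ X → v ∉ X → G.Adj u v → c u = c v) ∧
      ∀ i, ∀ F ⊆ S, (∀ v ∈ F, v ∉ X ∧ c v = i) → 2 * F.card ≤ S.card := by
  classical
  obtain ⟨ι, T, td, hw⟩ := hG
  have hne : ∀ v, ∃ z, v ∈ td.bag z := fun v => by
    obtain ⟨z⟩ := (td.bag_connected v).nonempty
    exact ⟨z, z.2⟩
  choose t ht using hne
  have : Nonempty ι := td.isTree.connected.nonempty
  let Φ : ι → ℕ := fun x => ∑ v ∈ S, T.dist x (t v)
  obtain ⟨x, hx⟩ : ∃ x, ∀ y, Φ x ≤ Φ y := ⟨Function.argmin Φ, fun y => Function.argmin_le Φ y⟩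
  obtain ⟨s, hs, hsd⟩ := exists_branch_label td.isTree x
  have hlabel : ∀ v y z, v ∉ td.bag x → v ∈ td.bag y → v ∈ td.bag z → s y = s z := by
    intro v y z hv hy hz
    refine eq_of_connected_induce (td.bag_connected v) (fun a ha b hb hab => hs a b ?_ ?_ hab) hy hz
    · rintro rfl; exact hv ha
    · rintro rfl; exact hv hb
  refine ⟨(td.bag x).toFinset, ι, fun v => s (t v), ?_, ?_, ?_⟩
  · rw [← Set.ncard_eq_toFinset_card']
    exact hw x
  · intro u v hu hv huv
    obtain ⟨y, hyu, hyv⟩ := td.bag_edge huv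
    rw [Set.mem_toFinset] at hu hv
    exact (hlabel u _ y hu (ht u) hyu).trans (hlabel v y _ hv hyv (ht v))
  · intro i F hFS hF
    rcases F.eq_empty_or_nonempty with rfl | ⟨v₀, hv₀⟩
    · simp
    have hnx : ∀ v ∈ F, t v ≠ x := by
      intro v hv h
      apply (hF v hv).1
      rw [Set.mem_toFinset, ← h]
      exact ht v
    have hxi : T.Adj x i := (hF v₀ hv₀).2 ▸ (hsd _ (hnx v₀ hv₀)).1
    have h1 : ∀ v ∈ F, T.dist i (t v) + 1 ≤ T.dist x (t v) := by
      intro v hv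
      have := (hsd _ (hnx v hv)).2
      rwa [show s (t v) = i from (hF v hv).2] at this
    have h2 : ∀ v, T.dist i (t v) ≤ T.dist x (t v) + 1 := by
      intro v
      have h := td.isTree.connected.dist_triangle (u := i) (v := x) (w := t v)
      rw [dist_eq_one_iff_adj.2 hxi.symm] at h
      omega
    have e1 : ∑ v ∈ F, (T.dist i (t v) + 1) ≤ ∑ v ∈ F, T.dist x (t v) := Finset.sum_le_sum h1
    have e2 : ∑ v ∈ S \ F, T.dist i (t v) ≤ ∑ v ∈ S \ F, (T.dist x (t v) + 1) :=
      Finset.sum_le_sum fun v _ => h2 v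
    have e3 := Finset.sum_sdiff (f := fun v => T.dist i (t v)) hFS
    have e4 := Finset.sum_sdiff (f := fun v => T.dist x (t v)) hFS
    have e5 := Finset.card_sdiff_add_card_eq_card hFS
    have e6 : ∑ v ∈ S, T.dist x (t v) ≤ ∑ v ∈ S, T.dist i (t v) := hx i
    simp only [Finset.sum_add_distrib, Finset.sum_const, smul_eq_mul, mul_one] at e1 e2
    omega

/-- No vertex of `A` coincides with or is adjacent to a vertex of `B`. -/
def Separated {V : Type*} (G : SimpleGraph V) (A B : Finset V) : Prop :=
  ∀ a ∈ A, ∀ b ∈ B, a ≠ b ∧ ¬ G.Adj a b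

/-- Pairwise separated subsets `A`, `B`, `R` of `S` such that `A` and `B` contain at most half of
the vertices of `S` each. -/
structure Splitting {V : Type*} (G : SimpleGraph V) (S A B R : Finset V) : Prop where
  sep_left_right : Separated G A B
  sep_left_rest : Separated G A R
  sep_right_rest : Separated G B R
  left_subset : A ⊆ S
  right_subset : B ⊆ S
  rest_subset : R ⊆ S
  card_left : 2 * A.card ≤ S.card
  card_right : 2 * B.card ≤ S.card

section Splitting

variable {V : Type*} {G : SimpleGraph V} {A B R S : Finset V}

lemma Separated.union_left [DecidableEq V] {A' : Finset V} (h : Separated G A B) (h' : Separated G A' B) :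
    Separated G (A ∪ A') B :=
  fun a ha b hb => (Finset.mem_union.1 ha).elim (fun ha => h a ha b hb) (fun ha => h' a ha b hb)

lemma Separated.symm (h : Separated G A B) : Separated G B A :=
  fun b hb a ha => ⟨(h a ha b hb).1.symm, fun hba => (h a ha b hb).2 hba.symm⟩

lemma Separated.disjoint (h : Separated G A B) : Disjoint A B :=
  Finset.disjoint_left.2 fun a ha hb => (h a ha a hb).1 rfl

lemma Separated.mono {A' B' : Finset V} (h : Separated G A B) (hA : A' ⊆ A) (hB : B' ⊆ B) :
    Separated G A' B' :=
  fun a ha b hb => h a (hA ha) b (hB hb)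

namespace Splitting

lemma symm (h : Splitting G S A B R) : Splitting G S B A R :=
  ⟨h.sep_left_right.symm, h.sep_right_rest, h.sep_left_rest, h.right_subset, h.left_subset,
    h.rest_subset, h.card_right, h.card_left⟩

lemma mono_rest {R' : Finset V} (h : Splitting G S A B R) (hR : R' ⊆ R) : Splitting G S A B R' :=
  ⟨h.sep_left_right, h.sep_left_rest.mono subset_rfl hR, h.sep_right_rest.mono subset_rfl hR,
    h.left_subset, h.right_subset, hR.trans h.rest_subset, h.card_left, h.card_right⟩

variable [DecidableEq V]

lemma card_add_le (h : Splitting G S A B R) : A.card + B.card + R.card ≤ S.card := by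
  rw [← Finset.card_union_of_disjoint h.sep_left_right.disjoint, ← Finset.card_union_of_disjoint
    (h.sep_left_rest.union_left h.sep_right_rest).disjoint]
  exact Finset.card_le_card
    (Finset.union_subset (Finset.union_subset h.left_subset h.right_subset) h.rest_subset)

lemma move_left {P : Finset V} (h : Splitting G S A B R) (hP : P ⊆ R)
    (hsep : Separated G P (R \ P)) (hcard : 2 * (A.card + P.card) ≤ S.card) :
    Splitting G S (A ∪ P) B (R \ P) where
  sep_left_right := h.sep_left_right.union_left (h.sep_right_rest.mono subset_rfl hP).symm
  sep_left_rest := (h.sep_left_rest.mono subset_rfl Finset.sdiff_subset).union_left hsep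
  sep_right_rest := h.sep_right_rest.mono subset_rfl Finset.sdiff_subset
  left_subset := Finset.union_subset h.left_subset (hP.trans h.rest_subset)
  right_subset := h.right_subset
  rest_subset := Finset.sdiff_subset.trans h.rest_subset
  card_left := (Nat.mul_le_mul_left 2 (Finset.card_union_le A P)).trans hcard
  card_right := h.card_right

/-- Classes of the rest can be distributed to the two sides until only one class is left. -/
lemma exists_single_class {ι : Type*} (c : V → ι) (n : ℕ) :
    ∀ {A B R : Finset V}, R.card ≤ n → Splitting G S A B R →
      (∀ u ∈ R, ∀ v ∈ R, G.Adj u v → c u = c v) →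
      ∃ A' B' R', Splitting G S A' B' R' ∧ A ∪ B ∪ R ⊆ A' ∪ B' ∪ R' ∧ R' ⊆ R ∧
        ∀ u ∈ R', ∀ v ∈ R', c u = c v := by
  classical
  induction n with
  | zero =>
    intro A B R hR h _
    obtain rfl : R = ∅ := Finset.card_eq_zero.1 (Nat.le_zero.1 hR)
    exact ⟨A, B, ∅, h, subset_rfl, subset_rfl, by simp⟩
  | succ n ih =>
    intro A B R hR h hc
    by_cases hone : ∀ u ∈ R, ∀ v ∈ R, c u = c v
    · exact ⟨A, B, R, h, subset_rfl, subset_rfl, hone⟩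
    push Not at hone
    obtain ⟨u, hu, v, hv, huv⟩ := hone
    let P : V → Finset V := fun x => R.filter fun y => c y = c x
    have hPR : ∀ x, P x ⊆ R := fun x => Finset.filter_subset _ _
    have hsep : ∀ x, Separated G (P x) (R \ P x) := by
      intro x a ha b hb
      have haR := (Finset.mem_filter.1 ha).1
      have hac := (Finset.mem_filter.1 ha).2
      obtain ⟨hbR, hbP⟩ := Finset.mem_sdiff.1 hb
      refine ⟨fun hab => hbP (hab ▸ ha), fun hab => hbP (Finset.mem_filter.2 ⟨hbR, ?_⟩)⟩
      rw [← hc a haR b hbR hab, hac]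
    have hlt : ∀ x ∈ R, (R \ P x).card ≤ n := by
      intro x hx
      have : (R \ P x).card < R.card := Finset.card_lt_card
        (Finset.sdiff_ssubset (hPR x) ⟨x, Finset.mem_filter.2 ⟨hx, rfl⟩⟩)
      omega
    have hdisj : Disjoint (P u) (P v) := Finset.disjoint_left.2 fun y hyu hyv =>
      huv ((Finset.mem_filter.1 hyu).2.symm.trans (Finset.mem_filter.1 hyv).2)
    have hcard : (P u).card + (P v).card ≤ R.card := by
      rw [← Finset.card_union_of_disjoint hdisj]
      exact Finset.card_le_card (Finset.union_subset (hPR u) (hPR v))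
    have htotal := h.card_add_le
    by_cases hfit : 2 * (A.card + (P u).card) ≤ S.card
    · obtain ⟨A', B', R', h', hsub, hR', hone⟩ := ih (hlt u hu) (h.move_left (hPR u) (hsep u) hfit)
        fun x hx y hy => hc x (Finset.sdiff_subset hx) y (Finset.sdiff_subset hy)
      refine ⟨A', B', R', h', subset_trans ?_ hsub, hR'.trans Finset.sdiff_subset, hone⟩
      intro y hy
      simp only [Finset.mem_union, Finset.mem_sdiff] at hy ⊢
      tauto
    · obtain ⟨B', A', R', h', hsub, hR', hone⟩ := ih (hlt v hv)
        (h.symm.move_left (hPR v) (hsep v) (by omega))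
        fun x hx y hy => hc x (Finset.sdiff_subset hx) y (Finset.sdiff_subset hy)
      refine ⟨A', B', R', h'.symm, ?_, hR'.trans Finset.sdiff_subset, hone⟩
      intro y hy
      have := @hsub y
      simp only [Finset.mem_union, Finset.mem_sdiff] at hy this ⊢
      tauto

end Splitting

variable [DecidableEq V] [Fintype V]

/-- Deleting `w` bags yields a splitting whose rest is a `2 ^ w`-th fraction of the whole set. -/
lemma HasTreewidthLE.exists_splitting {k : ℕ} (hG : HasTreewidthLE G k) (S : Finset V) (w : ℕ) :
    ∃ X A B R : Finset V, Splitting G S A B R ∧ S ⊆ X ∪ (A ∪ B ∪ R) ∧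
      X.card ≤ (k + 1) * w ∧ 2 ^ w * R.card ≤ S.card := by
  induction w with
  | zero =>
    refine ⟨∅, ∅, ∅, S, ⟨?_, ?_, ?_, ?_, ?_, subset_rfl, ?_, ?_⟩, ?_, ?_, ?_⟩ <;> simp [Separated]
  | succ w ih =>
    obtain ⟨X, A, B, R, h, hcover, hX, hR⟩ := ih
    obtain ⟨Y, ι, c, hY, hc, hhalf⟩ := hG.exists_balanced_separator R
    obtain ⟨A', B', R', h', hsub, hR', hone⟩ := Splitting.exists_single_class c _ le_rfl
      (h.mono_rest (Finset.sdiff_subset (s := R) (t := Y))) fun u hu v hv =>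
        hc u v (Finset.mem_sdiff.1 hu).2 (Finset.mem_sdiff.1 hv).2
    refine ⟨X ∪ Y, A', B', R', h', ?_, ?_, ?_⟩
    · intro v hv
      have h1 := hcover hv
      have h2 := @hsub v
      simp only [Finset.mem_union, Finset.mem_sdiff] at h1 h2 ⊢
      tauto
    · exact (Finset.card_union_le X Y).trans (by rw [mul_add, mul_one]; omega)
    · have hhalf' : 2 * R'.card ≤ R.card := by
        rcases R'.eq_empty_or_nonempty with rfl | ⟨u, hu⟩
        · simp
        · exact hhalf (c u) R' (hR'.trans Finset.sdiff_subset) fun v hv =>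
            ⟨(Finset.mem_sdiff.1 (hR' hv)).2, hone v hv u hu⟩
      calc 2 ^ (w + 1) * R'.card = 2 ^ w * (2 * R'.card) := by ring
        _ ≤ 2 ^ w * R.card := Nat.mul_le_mul_left _ hhalf'
        _ ≤ S.card := hR

/-- Deleting `w` bags splits a vertex set into two almost equal separated parts. -/
lemma HasTreewidthLE.exists_almost_bisection {k : ℕ} (hG : HasTreewidthLE G k) (S : Finset V)
    (w : ℕ) :
    ∃ X A B : Finset V, S ⊆ X ∪ (A ∪ B) ∧ Separated G A B ∧ X.card ≤ (k + 1) * w ∧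
      (A.card : ℝ) ≤ S.card * (1 / 2 + 1 / 2 ^ w) ∧
      (B.card : ℝ) ≤ S.card * (1 / 2 + 1 / 2 ^ w) := by
  obtain ⟨X, A, B, R, h, hcover, hX, hR⟩ := hG.exists_splitting S w
  have hA : 2 * (A.card : ℝ) ≤ S.card := by exact_mod_cast h.card_left
  have hB : 2 * (B.card : ℝ) ≤ S.card := by exact_mod_cast h.card_right
  have hR' : (R.card : ℝ) ≤ S.card * (1 / 2 ^ w) := by
    rw [mul_one_div, le_div_iff₀ (by positivity), mul_comm]
    exact_mod_cast hR
  have hAR : ((A ∪ R).card : ℝ) ≤ A.card + R.card := by exact_mod_cast Finset.card_union_le A R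
  have hpos : (0 : ℝ) ≤ S.card * (1 / 2 ^ w) := by positivity
  refine ⟨X, A ∪ R, B, ?_, h.sep_left_right.union_left h.sep_right_rest.symm, hX, ?_, ?_⟩
  · intro v hv
    have h1 := hcover hv
    simp only [Finset.mem_union] at h1 ⊢
    tauto
  · rw [mul_add]; linarith
  · rw [mul_add]; linarith

end Splitting

section JGraph

variable {a b m : ℕ}

lemma JGraph_adj_inl {i : Fin a} {y : JVert a b (m + 1)} :
    (JGraph a b (m + 1)).Adj (Sum.inl i : JVert a b (m + 1)) y ↔
      (Sum.inl i : JVert a b (m + 1)) ≠ y :=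
  ⟨Adj.ne, fun h => ⟨h, Or.inl trivial⟩⟩

lemma JGraph_adj_inr_inl {x y : JVert a b m} :
    (JGraph a b (m + 1)).Adj (Sum.inr (Sum.inl x) : JVert a b (m + 1))
      (Sum.inr (Sum.inl y) : JVert a b (m + 1)) ↔ (JGraph a b m).Adj x y := by
  constructor
  · rintro ⟨_, h | h⟩
    exacts [h, h.symm]
  · intro h
    exact ⟨fun he => h.ne (Sum.inl_injective (Sum.inr_injective he)), Or.inl h⟩

lemma JGraph_adj_inr_inr {x y : JVert a b m} :
    (JGraph a b (m + 1)).Adj (Sum.inr (Sum.inr x) : JVert a b (m + 1))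
      (Sum.inr (Sum.inr y) : JVert a b (m + 1)) ↔ (JGraph a b m).Adj x y := by
  constructor
  · rintro ⟨_, h | h⟩
    exacts [h, h.symm]
  · intro h
    exact ⟨fun he => h.ne (Sum.inr_injective (Sum.inr_injective he)), Or.inl h⟩

lemma not_JGraph_adj_inl_inr {x y : JVert a b m} :
    ¬ (JGraph a b (m + 1)).Adj (Sum.inr (Sum.inl x) : JVert a b (m + 1))
      (Sum.inr (Sum.inr y) : JVert a b (m + 1)) := by
  rintro ⟨_, h | h⟩ <;> exact h

instance JVert.finite (a b : ℕ) : ∀ m, Finite (JVert a b m)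
  | 0 => inferInstanceAs (Finite (Fin b))
  | m + 1 =>
    have := JVert.finite a b m
    inferInstanceAs (Finite (Fin a ⊕ (JVert a b m ⊕ JVert a b m)))

lemma card_JVert_zero : Nat.card (JVert a b 0) = b := Nat.card_fin b

lemma card_JVert_succ : Nat.card (JVert a b (m + 1)) = a + 2 * Nat.card (JVert a b m) := by
  change Nat.card (Fin a ⊕ (JVert a b m ⊕ JVert a b m)) = _
  rw [Nat.card_sum, Nat.card_sum, Nat.card_fin, two_mul]

lemma card_JVert_le (a b m : ℕ) : Nat.card (JVert a b m) + a ≤ 2 ^ m * (a + b) := by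
  induction m with
  | zero => rw [card_JVert_zero]; omega
  | succ m ih => rw [card_JVert_succ, pow_succ]; linarith

lemma ncard_edgeSet_JGraph_succ_le :
    (JGraph a b (m + 1)).edgeSet.ncard ≤
      a * Nat.card (JVert a b (m + 1)) + 2 * (JGraph a b m).edgeSet.ncard := by
  let E := (JGraph a b m).edgeSet
  let root : Fin a × JVert a b (m + 1) → Sym2 (JVert a b (m + 1)) :=
    fun p => s((Sum.inl p.1 : JVert a b (m + 1)), p.2)
  let left : JVert a b m → JVert a b (m + 1) := fun x => Sum.inr (Sum.inl x)
  let right : JVert a b m → JVert a b (m + 1) := fun x => Sum.inr (Sum.inr x)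
  have hsub : (JGraph a b (m + 1)).edgeSet ⊆
      root '' Set.univ ∪ (Sym2.map left '' E ∪ Sym2.map right '' E) := by
    intro e
    induction e using Sym2.ind with
    | _ u v =>
      intro h
      rw [mem_edgeSet] at h
      match u, v, h with
      | Sum.inl i, v, _ => exact Or.inl ⟨(i, v), trivial, rfl⟩
      | u, Sum.inl i, _ => exact Or.inl ⟨(i, u), trivial, Sym2.eq_swap⟩
      | Sum.inr (Sum.inl x), Sum.inr (Sum.inl y), h =>
        exact Or.inr (Or.inl ⟨s(x, y), JGraph_adj_inr_inl.1 h, rfl⟩)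
      | Sum.inr (Sum.inr x), Sum.inr (Sum.inr y), h =>
        exact Or.inr (Or.inr ⟨s(x, y), JGraph_adj_inr_inr.1 h, rfl⟩)
      | Sum.inr (Sum.inl x), Sum.inr (Sum.inr y), h => exact (not_JGraph_adj_inl_inr h).elim
      | Sum.inr (Sum.inr x), Sum.inr (Sum.inl y), h => exact (not_JGraph_adj_inl_inr h.symm).elim
  have h1 : (root '' Set.univ).ncard ≤ a * Nat.card (JVert a b (m + 1)) := by
    refine (Set.ncard_image_le).trans ?_
    rw [Set.ncard_univ, Nat.card_prod, Nat.card_fin]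
  have h2 : (Sym2.map left '' E).ncard ≤ E.ncard := Set.ncard_image_le
  have h3 : (Sym2.map right '' E).ncard ≤ E.ncard := Set.ncard_image_le
  have h4 := Set.ncard_le_ncard hsub
  have h5 := Set.ncard_union_le (root '' Set.univ) (Sym2.map left '' E ∪ Sym2.map right '' E)
  have h6 := Set.ncard_union_le (Sym2.map left '' E) (Sym2.map right '' E)
  change _ ≤ _ + 2 * E.ncard
  omega

lemma ncard_edgeSet_JGraph_le (a b m : ℕ) :
    (JGraph a b m).edgeSet.ncard ≤ (a * m + b) * Nat.card (JVert a b m) := by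
  induction m with
  | zero =>
    have hsub : (JGraph a b 0).edgeSet ⊆
        (fun p : JVert a b 0 × JVert a b 0 => s(p.1, p.2)) '' Set.univ := by
      intro e _
      induction e using Sym2.ind with
      | _ u v => exact ⟨(u, v), trivial, rfl⟩
    refine (Set.ncard_le_ncard hsub).trans ((Set.ncard_image_le Set.finite_univ).trans ?_)
    rw [Set.ncard_univ, Nat.card_prod, card_JVert_zero]
    simp
  | succ m ih =>
    have h := ncard_edgeSet_JGraph_succ_le (a := a) (b := b) (m := m)
    have hcard := card_JVert_succ (a := a) (b := b) (m := m)
    have : 2 * ((a * m + b) * Nat.card (JVert a b m)) ≤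
        (a * m + b) * Nat.card (JVert a b (m + 1)) := by
      rw [hcard]
      calc 2 * ((a * m + b) * Nat.card (JVert a b m))
          = (a * m + b) * (2 * Nat.card (JVert a b m)) := by ring
        _ ≤ _ := Nat.mul_le_mul_left _ (Nat.le_add_left _ _)
    calc _ ≤ a * Nat.card (JVert a b (m + 1)) + (a * m + b) * Nat.card (JVert a b (m + 1)) := by
          omega
      _ = _ := by ring

/-- A nonempty initial segment receives an injection from every finset that is not larger. -/
lemma exists_injOn_fin {V : Type*} {S : Finset V} (hb : 0 < b) (h : S.card ≤ b) :
    ∃ f : V → Fin b, Set.InjOn f S := by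
  classical
  refine ⟨fun v => if hv : v ∈ S then Fin.castLE h (S.equivFin ⟨v, hv⟩) else ⟨0, hb⟩, ?_⟩
  intro u hu v hv huv
  rw [Finset.mem_coe] at hu hv
  simp only [hu, hv, dif_pos] at huv
  exact congrArg Subtype.val (S.equivFin.injective (Fin.castLE_injective h huv))

/-- Every sufficiently small vertex set of a graph of bounded treewidth embeds into `JGraph`. -/
lemma HasTreewidthLE.exists_embedding_JGraph {V : Type*} [Fintype V] {G : SimpleGraph V} {k w : ℕ}
    (hG : HasTreewidthLE G k) (hw : 0 < w) (hb : 0 < b) (m : ℕ) (S : Finset V)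
    (hS : S.card * (1 / 2 + 1 / 2 ^ w : ℝ) ^ m ≤ b) :
    ∃ f : V → JVert ((k + 1) * w) b m, Set.InjOn f S ∧
      ∀ u ∈ S, ∀ v ∈ S, G.Adj u v → (JGraph ((k + 1) * w) b m).Adj (f u) (f v) := by
  classical
  induction m generalizing S with
  | zero =>
    have hSb : S.card ≤ b := by
      rw [pow_zero, mul_one] at hS
      exact_mod_cast hS
    obtain ⟨f, hf⟩ := exists_injOn_fin hb hSb
    refine ⟨f, hf, fun u hu v hv huv => ?_⟩
    change f u ≠ f v
    exact fun h => huv.ne (hf hu hv h)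
  | succ m ih =>
    obtain ⟨X, A, B, hcover, hsep, hX, hA, hB⟩ := hG.exists_almost_bisection S w
    have hpart : ∀ P : Finset V, (P.card : ℝ) ≤ S.card * (1 / 2 + 1 / 2 ^ w) →
        P.card * (1 / 2 + 1 / 2 ^ w : ℝ) ^ m ≤ b := by
      intro P hP
      refine le_trans ?_ hS
      rw [pow_succ', ← mul_assoc]
      gcongr
    obtain ⟨g, hg⟩ := exists_injOn_fin (Nat.mul_pos k.succ_pos hw) hX
    obtain ⟨fA, hfA, hfA'⟩ := ih A (hpart A hA)
    obtain ⟨fB, hfB, hfB'⟩ := ih B (hpart B hB)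
    let f : V → JVert ((k + 1) * w) b (m + 1) := fun v =>
      if v ∈ X then Sum.inl (g v) else if v ∈ A then Sum.inr (Sum.inl (fA v))
        else Sum.inr (Sum.inr (fB v))
    have hcases : ∀ v ∈ S, (v ∈ X ∧ f v = Sum.inl (g v)) ∨
        (v ∈ A ∧ f v = Sum.inr (Sum.inl (fA v))) ∨ (v ∈ B ∧ f v = Sum.inr (Sum.inr (fB v))) := by
      intro v hv
      have := hcover hv
      simp only [Finset.mem_union] at this
      by_cases hvX : v ∈ X
      · exact Or.inl ⟨hvX, if_pos hvX⟩
      by_cases hvA : v ∈ A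
      · exact Or.inr (Or.inl ⟨hvA, (if_neg hvX).trans (if_pos hvA)⟩)
      · exact Or.inr (Or.inr ⟨by tauto, (if_neg hvX).trans (if_neg hvA)⟩)
    have hf : Set.InjOn f S := by
      intro u hu v hv huv
      rcases hcases u hu with ⟨hu, hfu⟩ | ⟨hu, hfu⟩ | ⟨hu, hfu⟩ <;>
      rcases hcases v hv with ⟨hv, hfv⟩ | ⟨hv, hfv⟩ | ⟨hv, hfv⟩ <;>
      rw [hfu, hfv] at huv
      · exact hg hu hv (Sum.inl_injective huv)
      · cases huv
      · cases huv
      · cases huv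
      · exact hfA hu hv (Sum.inl_injective (Sum.inr_injective huv))
      · cases huv
      · cases huv
      · cases huv
      · exact hfB hu hv (Sum.inr_injective (Sum.inr_injective huv))
    refine ⟨f, hf, fun u hu v hv huv => ?_⟩
    have hne : f u ≠ f v := fun h => huv.ne (hf hu hv h)
    rcases hcases u hu with ⟨hu, hfu⟩ | ⟨hu, hfu⟩ | ⟨hu, hfu⟩
    · rw [hfu] at hne ⊢
      exact JGraph_adj_inl.2 hne
    all_goals
      rcases hcases v hv with ⟨hv, hfv⟩ | ⟨hv, hfv⟩ | ⟨hv, hfv⟩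
      · rw [hfv] at hne ⊢
        exact (JGraph_adj_inl.2 hne.symm).symm
    · rw [hfu, hfv]
      exact JGraph_adj_inr_inl.2 (hfA' u hu v hv huv)
    · exact ((hsep u hu v hv).2 huv).elim
    · exact ((hsep v hv u hu).2 huv.symm).elim
    · rw [hfu, hfv]
      exact JGraph_adj_inr_inr.2 (hfB' u hu v hv huv)

end JGraph

lemma succ_mul_add_two_le_two_pow {k q : ℕ} (hq : 2 * k + 6 ≤ q) :
    (k + 1) * (q + 2) ≤ 2 ^ q := by
  have hk : k + 1 ≤ 2 ^ k := Nat.lt_two_pow_self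
  induction q, hq using Nat.le_induction with
  | base =>
    calc (k + 1) * (2 * k + 6 + 2) ≤ 64 * ((k + 1) * (k + 1)) := by nlinarith
      _ ≤ 64 * (2 ^ k * 2 ^ k) := Nat.mul_le_mul_left _ (Nat.mul_le_mul hk hk)
      _ = 2 ^ (2 * k + 6) := by ring
  | succ q hq ih =>
    have : 2 ^ k ≤ 2 ^ q := Nat.pow_le_pow_right two_pos (by omega)
    rw [pow_succ]
    linarith

lemma one_half_add_pow_le {m q : ℕ} (hm : m ≤ 2 ^ (q + 1)) :
    (1 / 2 + 1 / 2 ^ (q + 2) : ℝ) ^ m ≤ 3 / 2 ^ m := by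
  have hm' : (m : ℝ) * (1 / 2 ^ (q + 1)) ≤ 1 := by
    rw [mul_one_div, div_le_one (by positivity)]
    exact_mod_cast hm
  have h : (1 + 1 / 2 ^ (q + 1) : ℝ) ^ m ≤ 3 := by
    calc (1 + 1 / 2 ^ (q + 1) : ℝ) ^ m ≤ Real.exp (1 / 2 ^ (q + 1)) ^ m := by
          gcongr
          rw [add_comm]
          exact Real.add_one_le_exp _
      _ = Real.exp (m * (1 / 2 ^ (q + 1))) := (Real.exp_nat_mul _ _).symm
      _ ≤ Real.exp 1 := Real.exp_le_exp.2 hm'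
      _ ≤ 3 := Real.exp_one_lt_three.le
  calc (1 / 2 + 1 / 2 ^ (q + 2) : ℝ) ^ m = ((1 + 1 / 2 ^ (q + 1)) / 2) ^ m := by
        congr 1; ring
    _ = (1 + 1 / 2 ^ (q + 1)) ^ m / 2 ^ m := div_pow _ _ _
    _ ≤ 3 / 2 ^ m := by gcongr

theorem statement_18 (k : ℕ) (hk : 1 ≤ k) :
    ∃ C : ℝ, 0 < C ∧ ∃ N : ℕ, ∀ n : ℕ, N ≤ n →
      ∃ (V : Type) (U : SimpleGraph V), Finite V ∧
        (Nat.card V : ℝ) ≤ 20 * n ∧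
        (U.edgeSet.ncard : ℝ) ≤ 20 * k * n * Real.logb 2 n * Real.logb (3/2) (Real.logb 2 n)
            + C * k * n * Real.log n ∧
        ∀ G : SimpleGraph (Fin n), HasTreewidthLE G k → Contains U G := by
  refine ⟨140, by norm_num, 2 ^ 2 ^ (2 * k + 6), fun n hn => ?_⟩
  have hn0 : n ≠ 0 := fun h => by simp [h] at hn
  obtain ⟨l, hl⟩ : ∃ l, l = Nat.log 2 n := ⟨_, rfl⟩
  obtain ⟨q, hq⟩ : ∃ q, q = Nat.log 2 l := ⟨_, rfl⟩
  have hl1 : 2 ^ (2 * k + 6) ≤ l := hl ▸ Nat.le_log_of_pow_le one_lt_two hn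
  have hq1 : 2 * k + 6 ≤ q := hq ▸ Nat.le_log_of_pow_le one_lt_two hl1
  have hl0 : l ≠ 0 := fun h => by simp [h] at hl1
  have hln : 2 ^ l ≤ n := hl ▸ Nat.pow_log_le_self 2 hn0
  have hnl : n < 2 ^ (l + 1) := hl ▸ Nat.lt_pow_succ_log_self one_lt_two n
  have hql : 2 ^ q ≤ l := hq ▸ Nat.pow_log_le_self 2 hl0
  have hlq : l < 2 ^ (q + 1) := hq ▸ Nat.lt_pow_succ_log_self one_lt_two l
  have hle : q ≤ l := Nat.lt_two_pow_self.le.trans hql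
  have hpow : 2 ^ (l - q) * 2 ^ q = 2 ^ l := by rw [← pow_add, Nat.sub_add_cancel hle]
  have ha := succ_mul_add_two_le_two_pow hq1
  have hcard : Nat.card (JVert ((k + 1) * (q + 2)) (6 * 2 ^ q) (l - q)) ≤ 7 * n := by
    calc _ ≤ 2 ^ (l - q) * ((k + 1) * (q + 2) + 6 * 2 ^ q) :=
          (Nat.le_add_right _ _).trans (card_JVert_le _ _ _)
      _ ≤ 2 ^ (l - q) * (7 * 2 ^ q) := Nat.mul_le_mul_left _ (by omega)
      _ = 7 * 2 ^ l := by rw [← hpow]; ring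
      _ ≤ 7 * n := Nat.mul_le_mul_left _ hln
  refine ⟨JVert ((k + 1) * (q + 2)) (6 * 2 ^ q) (l - q), JGraph _ _ _, inferInstance, ?_, ?_, ?_⟩
  · have : (Nat.card (JVert ((k + 1) * (q + 2)) (6 * 2 ^ q) (l - q)) : ℝ) ≤ 7 * n := by
      exact_mod_cast hcard
    have hn' : (0 : ℝ) ≤ n := n.cast_nonneg
    linarith
  · have hedges : (JGraph ((k + 1) * (q + 2)) (6 * 2 ^ q) (l - q)).edgeSet.ncard ≤
        k * n * (l * (14 * q + 70)) := by
      calc _ ≤ ((k + 1) * (q + 2) * (l - q) + 6 * 2 ^ q) * _ := ncard_edgeSet_JGraph_le _ _ _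
        _ ≤ ((k + 1) * (q + 2) * l + 6 * l) * (7 * n) := by
            gcongr
            exact Nat.sub_le l q
        _ = ((k + 1) * (q + 2) + 6) * (7 * l * n) := by ring
        _ ≤ (k * (2 * q + 10)) * (7 * l * n) := by
            refine Nat.mul_le_mul_right _ ?_
            nlinarith [Nat.mul_le_mul_right q hk]
        _ = _ := by ring
    have hedges' : ((JGraph ((k + 1) * (q + 2)) (6 * 2 ^ q) (l - q)).edgeSet.ncard : ℝ) ≤
        k * n * (l * (14 * q + 70)) := by exact_mod_cast hedges
    have hL : (l : ℝ) ≤ Real.logb 2 n := by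
      rw [Real.le_logb_iff_rpow_le one_lt_two (by positivity), Real.rpow_natCast]
      exact_mod_cast hln
    have hl0' : (0 : ℝ) < l := by positivity
    have hM : (q : ℝ) ≤ Real.logb (3 / 2) (Real.logb 2 n) := by
      rw [Real.le_logb_iff_rpow_le (by norm_num) (hl0'.trans_le hL), Real.rpow_natCast]
      calc (3 / 2 : ℝ) ^ q ≤ 2 ^ q := by gcongr; norm_num
        _ ≤ l := by exact_mod_cast hql
        _ ≤ _ := hL
    have hlog : Real.logb 2 n ≤ 2 * Real.log n := by
      have hlog2 : (1 : ℝ) / 2 ≤ Real.log 2 := by linarith [Real.log_two_gt_d9]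
      rw [Real.logb, div_le_iff₀ (by positivity)]
      nlinarith [Real.log_natCast_nonneg n]
    have hL0 := hl0'.le.trans hL
    have hM0 : 0 ≤ Real.logb (3 / 2) (Real.logb 2 n) := (Nat.cast_nonneg q).trans hM
    have hLM := mul_nonneg hL0 hM0
    calc _ ≤ (k : ℝ) * n * (l * (14 * q + 70)) := hedges'
      _ ≤ k * n * (Real.logb 2 n * (14 * Real.logb (3 / 2) (Real.logb 2 n) + 70)) := by gcongr
      _ ≤ k * n * (20 * (Real.logb 2 n * Real.logb (3 / 2) (Real.logb 2 n)) +
            140 * Real.log n) := by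
          gcongr
          linarith
      _ = _ := by ring
  · intro G hG
    obtain ⟨f, hf, hadj⟩ := hG.exists_embedding_JGraph (w := q + 2) (b := 6 * 2 ^ q)
      (Nat.succ_pos _) (by positivity) (l - q) Finset.univ (by
        have h := one_half_add_pow_le (m := l - q) (q := q) ((Nat.sub_le l q).trans hlq.le)
        have hn2 : (n : ℝ) ≤ 2 * (2 ^ (l - q) * 2 ^ q) := by
          rw [pow_succ'] at hnl
          have := hnl.le
          rw [← hpow] at this
          exact_mod_cast this
        rw [Finset.card_univ, Fintype.card_fin]
        calc (n : ℝ) * (1 / 2 + 1 / 2 ^ (q + 2)) ^ (l - q)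
            ≤ 2 * (2 ^ (l - q) * 2 ^ q) * (3 / 2 ^ (l - q)) := by gcongr
          _ = 6 * 2 ^ q := by field_simp; norm_num
          _ = _ := by push_cast; rfl)
    exact ⟨⟨f, fun {u v} h => hadj u (Finset.mem_univ u) v (Finset.mem_univ v) h⟩,
      fun u v h => hf (Finset.mem_coe.2 (Finset.mem_univ u))
        (Finset.mem_coe.2 (Finset.mem_univ v)) h⟩
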